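/- Over ϑ ∈ H²((−a,0)) subject to the constraint ∫_{−a}^0((ϑ'')² + 2k²(ϑ')² + k⁴ϑ²)dx₃ = 1, the quantity 2k²(ϑ'(0)ϑ(0) − ϑ'(−a)ϑ(−a)) attains a minimum equal to −(sinh(ka)+ka)/(3sinh(ka)−ka) and a maximum equal to 1. -/

import Mathlib

/-!
STATEMENT 5: Over ϑ ∈ H²((−a,0)) with ∫((ϑ'')² + 2k²(ϑ')² + k⁴ϑ²) = 1, the quantity
2k²(ϑ'(0)ϑ(0) − ϑ'(−a)ϑ(−a)) attains the minimum −(sinh(ka)+ka)/(3sinh(ka)−ka)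
and the maximum 1.
-/

open MeasureTheory Real Set Filter

noncomputable section

/-- The general solution of `(D² - 1)² u = 0`. -/
def modes (A B D F z : ℝ) : ℝ :=
  A * cosh z + B * (z * sinh z) + D * sinh z + F * (z * cosh z)

lemma hasDerivAt_modes (A B D F z : ℝ) :
    HasDerivAt (modes A B D F) (modes (D + F) F (A + B) B z) z := by
  have hc := Real.hasDerivAt_cosh z
  have hs := Real.hasDerivAt_sinh z
  have hi := hasDerivAt_id z
  refine HasDerivAt.congr_deriv (f := modes A B D F)
    ((((hc.const_mul A).add ((hi.mul hs).const_mul B)).add (hs.const_mul D)).add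
      ((hi.mul hc).const_mul F)) ?_
  simp only [modes, id]
  ring

lemma hasDerivAt_modes_comp (A B D F k c x : ℝ) :
    HasDerivAt (fun x => modes A B D F (k * (x + c)))
      (k * modes (D + F) F (A + B) B (k * (x + c))) x := by
  have h : HasDerivAt (fun x : ℝ => k * (x + c)) k x := by
    simpa using ((hasDerivAt_id x).add_const c).const_mul k
  simpa [mul_comm, Function.comp_def] using (hasDerivAt_modes A B D F (k * (x + c))).comp x h

lemma contDiff_modes_comp (A B D F k c : ℝ) :
    ContDiff ℝ 2 (fun x => modes A B D F (k * (x + c))) := by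
  unfold modes
  fun_prop

lemma deriv_modes_comp (A B D F k c : ℝ) :
    deriv (fun x => modes A B D F (k * (x + c))) =
      fun x => k * modes (D + F) F (A + B) B (k * (x + c)) :=
  funext fun x => (hasDerivAt_modes_comp A B D F k c x).deriv

/-- The pointwise energy `(ϑ'')² + 2k²(ϑ')² + k⁴ϑ²`. -/
def energyDensity (k : ℝ) (ϑ : ℝ → ℝ) (x : ℝ) : ℝ :=
  (iteratedDeriv 2 ϑ x) ^ 2 + 2 * k ^ 2 * (deriv ϑ x) ^ 2 + k ^ 4 * (ϑ x) ^ 2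

/-- The boundary term `2k²(ϑ'(0)ϑ(0) - ϑ'(-a)ϑ(-a))`. -/
def boundaryTerm (a k : ℝ) (ϑ : ℝ → ℝ) : ℝ :=
  2 * k ^ 2 * (deriv ϑ 0 * ϑ 0 - deriv ϑ (-a) * ϑ (-a))

/-- The values of the boundary term on functions of unit energy. -/
def boundaryValues (a k : ℝ) : Set ℝ :=
  {v : ℝ | ∃ ϑ : ℝ → ℝ, ContDiff ℝ 2 ϑ ∧
    (∫ x in Ioo (-a) (0 : ℝ), energyDensity k ϑ x) = 1 ∧ v = boundaryTerm a k ϑ}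

lemma hasDerivAt_of_contDiff_two {ϑ : ℝ → ℝ} (h : ContDiff ℝ 2 ϑ) (x : ℝ) :
    HasDerivAt ϑ (deriv ϑ x) x :=
  (h.differentiable (by norm_num) x).hasDerivAt

lemma hasDerivAt_deriv_of_contDiff_two {ϑ : ℝ → ℝ} (h : ContDiff ℝ 2 ϑ) (x : ℝ) :
    HasDerivAt (deriv ϑ) (iteratedDeriv 2 ϑ x) x := by
  have := h.differentiable_iteratedDeriv 1 (by norm_num)
  rw [iteratedDeriv_one] at this
  rw [iteratedDeriv_succ, iteratedDeriv_one]
  exact (this x).hasDerivAt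

lemma continuous_energyDensity {ϑ : ℝ → ℝ} (h : ContDiff ℝ 2 ϑ) (k : ℝ) :
    Continuous (energyDensity k ϑ) := by
  have h0 := h.continuous
  have h1 := h.continuous_deriv (by norm_num)
  have h2 := h.continuous_iteratedDeriv 2 le_rfl
  unfold energyDensity
  fun_prop

lemma setIntegral_Ioo_eq_sub {a : ℝ} (ha : 0 < a) {Φ φ : ℝ → ℝ}
    (hΦ : ∀ x, HasDerivAt Φ (φ x) x) (hφ : Continuous φ) :
    (∫ x in Ioo (-a) (0 : ℝ), φ x) = Φ 0 - Φ (-a) := by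
  rw [← integral_Ioc_eq_integral_Ioo, ← intervalIntegral.integral_of_le (by linarith)]
  exact intervalIntegral.integral_eq_sub_of_hasDerivAt (fun x _ => hΦ x)
    (hφ.intervalIntegrable _ _)

lemma sub_le_setIntegral_Ioo {a : ℝ} (ha : 0 < a) {Φ φ g : ℝ → ℝ}
    (hΦ : ∀ x, HasDerivAt Φ (φ x) x) (hφ : Continuous φ) (hg : Continuous g)
    (hle : ∀ x, φ x ≤ g x) :
    Φ 0 - Φ (-a) ≤ ∫ x in Ioo (-a) (0 : ℝ), g x := by
  rw [← setIntegral_Ioo_eq_sub ha hΦ hφ]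
  have hint : ∀ f : ℝ → ℝ, Continuous f → IntegrableOn f (Ioo (-a) (0 : ℝ)) := fun f hf =>
    (hf.integrableOn_Icc (a := -a) (b := 0)).mono_set Ioo_subset_Icc_self
  exact integral_mono (hint φ hφ) (hint g hg) hle

lemma boundaryTerm_le_energy {a k : ℝ} (ha : 0 < a) {ϑ : ℝ → ℝ} (h : ContDiff ℝ 2 ϑ) :
    boundaryTerm a k ϑ ≤ ∫ x in Ioo (-a) (0 : ℝ), energyDensity k ϑ x := by
  have h0 := h.continuous
  have h1 := h.continuous_deriv (by norm_num)
  have h2 := h.continuous_iteratedDeriv 2 le_rfl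
  have key := sub_le_setIntegral_Ioo ha
    (Φ := fun x => 2 * k ^ 2 * (deriv ϑ x * ϑ x))
    (φ := fun x => 2 * k ^ 2 * (iteratedDeriv 2 ϑ x * ϑ x + deriv ϑ x * deriv ϑ x))
    (fun x => ((hasDerivAt_deriv_of_contDiff_two h x).mul
      (hasDerivAt_of_contDiff_two h x)).const_mul _)
    (by fun_prop) (continuous_energyDensity h k) (fun x => by
      unfold energyDensity
      nlinarith [sq_nonneg (iteratedDeriv 2 ϑ x - k ^ 2 * ϑ x)])
  unfold boundaryTerm
  linarith

/-- The flux `ϑ'p'' - ϑp''' + 2k²ϑp'` whose derivative, for a solution `p` of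
`(D² - k²)² p = 0`, is the energy pairing of `ϑ` and `p`. -/
def flux (A B D F k c : ℝ) (ϑ : ℝ → ℝ) (x : ℝ) : ℝ :=
  deriv ϑ x * (k ^ 2 * modes (A + B + B) B (D + F + F) F (k * (x + c)))
    - ϑ x * (k ^ 3 * modes (D + F + F + F) F (A + B + B + B) B (k * (x + c)))
    + 2 * k ^ 2 * (ϑ x * (k * modes (D + F) F (A + B) B (k * (x + c))))

lemma hasDerivAt_flux (A B D F k c : ℝ) {ϑ : ℝ → ℝ} (h : ContDiff ℝ 2 ϑ) (x : ℝ) :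
    HasDerivAt (flux A B D F k c ϑ)
      (iteratedDeriv 2 ϑ x * (k ^ 2 * modes (A + B + B) B (D + F + F) F (k * (x + c)))
        + 2 * k ^ 2 * (deriv ϑ x * (k * modes (D + F) F (A + B) B (k * (x + c))))
        + k ^ 4 * (ϑ x * modes A B D F (k * (x + c)))) x := by
  have d0 := hasDerivAt_of_contDiff_two h x
  have d1 := hasDerivAt_deriv_of_contDiff_two h x
  have p1 := (hasDerivAt_modes_comp (D + F) F (A + B) B k c x).const_mul k
  have p2 := (hasDerivAt_modes_comp (A + B + B) B (D + F + F) F k c x).const_mul (k ^ 2)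
  have p3 := (hasDerivAt_modes_comp (D + F + F + F) F (A + B + B + B) B k c x).const_mul (k ^ 3)
  refine HasDerivAt.congr_deriv (f := flux A B D F k c ϑ)
    (((d1.mul p2).sub (d0.mul p3)).add ((d0.mul p1).const_mul (2 * k ^ 2))) ?_
  simp only [modes]
  ring

lemma iteratedDeriv_two_modes_comp (A B D F k c : ℝ) :
    iteratedDeriv 2 (fun x => modes A B D F (k * (x + c))) =
      fun x => k ^ 2 * modes (A + B + B) B (D + F + F) F (k * (x + c)) := by
  rw [iteratedDeriv_succ, iteratedDeriv_one, deriv_modes_comp]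
  funext x
  rw [((hasDerivAt_modes_comp (D + F) F (A + B) B k c x).const_mul k).deriv]
  ring

lemma hasDerivAt_flux_modes_comp (A B D F k c x : ℝ) :
    HasDerivAt (flux A B D F k c (fun x => modes A B D F (k * (x + c))))
      (energyDensity k (fun x => modes A B D F (k * (x + c))) x) x := by
  convert hasDerivAt_flux A B D F k c (contDiff_modes_comp A B D F k c) x using 1
  rw [energyDensity, iteratedDeriv_two_modes_comp, deriv_modes_comp]
  ring

/-- The energy of `modes` on the symmetric interval of half-length `τ`, at `k = 1`. -/
def modesEnergy (A B D F τ : ℝ) : ℝ :=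
  4 * ((A * cosh τ + B * (τ * sinh τ)) * ((A + B) * sinh τ + B * (τ * cosh τ))
      + (D * sinh τ + F * (τ * cosh τ)) * ((D + F) * cosh τ + F * (τ * sinh τ))
      + B ^ 2 * (sinh τ * cosh τ + τ) + F ^ 2 * (sinh τ * cosh τ - τ))

/-- The boundary term of `modes` on the symmetric interval of half-length `τ`,
at `k = 1`. -/
def modesBoundary (A B D F τ : ℝ) : ℝ :=
  4 * ((A * cosh τ + B * (τ * sinh τ)) * ((A + B) * sinh τ + B * (τ * cosh τ))
      + (D * sinh τ + F * (τ * cosh τ)) * ((D + F) * cosh τ + F * (τ * sinh τ)))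

/-- `ϑ` has the same boundary data at `-a` and `0` as `x ↦ modes A B D F (k * (x + a / 2))`. -/
structure MatchesModes (a k A B D F : ℝ) (ϑ : ℝ → ℝ) : Prop where
  right : ϑ 0 = modes A B D F (k * (a / 2))
  left : ϑ (-a) = modes A B D F (-(k * (a / 2)))
  deriv_right : deriv ϑ 0 = k * modes (D + F) F (A + B) B (k * (a / 2))
  deriv_left : deriv ϑ (-a) = k * modes (D + F) F (A + B) B (-(k * (a / 2)))

lemma matchesModes_modes_comp (a k A B D F : ℝ) :
    MatchesModes a k A B D F (fun x => modes A B D F (k * (x + a / 2))) := by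
  have e0 : k * (0 + a / 2) = k * (a / 2) := by ring
  have e1 : k * (-a + a / 2) = -(k * (a / 2)) := by ring
  constructor <;> simp only [deriv_modes_comp, e0, e1]

lemma boundaryTerm_eq_modesBoundary (A B D F : ℝ) {a k : ℝ} {ϑ : ℝ → ℝ}
    (hm : MatchesModes a k A B D F ϑ) :
    boundaryTerm a k ϑ = k ^ 3 * modesBoundary A B D F (k * (a / 2)) := by
  rw [boundaryTerm, hm.right, hm.left, hm.deriv_right, hm.deriv_left]
  simp only [modes, modesBoundary, cosh_neg, sinh_neg]
  ring

lemma flux_sub_eq_modesEnergy (A B D F : ℝ) {a k : ℝ} {ϑ : ℝ → ℝ}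
    (hm : MatchesModes a k A B D F ϑ) :
    flux A B D F k (a / 2) ϑ 0 - flux A B D F k (a / 2) ϑ (-a) =
      k ^ 3 * modesEnergy A B D F (k * (a / 2)) := by
  have e0 : k * (0 + a / 2) = k * (a / 2) := by ring
  have e1 : k * (-a + a / 2) = -(k * (a / 2)) := by ring
  rw [flux, flux, hm.right, hm.left, hm.deriv_right, hm.deriv_left, e0, e1]
  generalize k * (a / 2) = τ
  have hC := cosh_sq τ
  simp only [modes, modesEnergy, cosh_neg, sinh_neg]
  linear_combination (4 * k ^ 3 * τ * (B ^ 2 - F ^ 2)) * hC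

lemma energy_modes_comp (A B D F k : ℝ) {a : ℝ} (ha : 0 < a) :
    (∫ x in Ioo (-a) (0 : ℝ),
      energyDensity k (fun x => modes A B D F (k * (x + a / 2))) x) =
      k ^ 3 * modesEnergy A B D F (k * (a / 2)) := by
  have h := contDiff_modes_comp A B D F k (a / 2)
  rw [← flux_sub_eq_modesEnergy A B D F (matchesModes_modes_comp a k A B D F)]
  exact setIntegral_Ioo_eq_sub ha (hasDerivAt_flux_modes_comp A B D F k (a / 2))
    (continuous_energyDensity h k)

lemma modesEnergy_le_energy (A B D F : ℝ) {a k : ℝ} (ha : 0 < a) {ϑ : ℝ → ℝ}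
    (h : ContDiff ℝ 2 ϑ)
    (hm : MatchesModes a k A B D F ϑ) :
    k ^ 3 * modesEnergy A B D F (k * (a / 2)) ≤
      ∫ x in Ioo (-a) (0 : ℝ), energyDensity k ϑ x := by
  have hp := contDiff_modes_comp A B D F k (a / 2)
  have hcont : ∀ A B D F : ℝ, Continuous fun x => modes A B D F (k * (x + a / 2)) :=
    fun A B D F => (contDiff_modes_comp A B D F k (a / 2)).continuous
  have c0 := hcont A B D F
  have c1 := hcont (D + F) F (A + B) B
  have c2 := hcont (A + B + B) B (D + F + F) F
  have h0 := h.continuous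
  have h1 := h.continuous_deriv (by norm_num)
  have h2 := h.continuous_iteratedDeriv 2 le_rfl
  have hcφ : Continuous fun x =>
      2 * (iteratedDeriv 2 ϑ x * (k ^ 2 * modes (A + B + B) B (D + F + F) F (k * (x + a / 2)))
        + 2 * k ^ 2 * (deriv ϑ x * (k * modes (D + F) F (A + B) B (k * (x + a / 2))))
        + k ^ 4 * (ϑ x * modes A B D F (k * (x + a / 2))))
      - energyDensity k (fun x => modes A B D F (k * (x + a / 2))) x :=
    Continuous.sub (by fun_prop) (continuous_energyDensity hp k)
  have key := sub_le_setIntegral_Ioo ha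
    (Φ := fun x => 2 * flux A B D F k (a / 2) ϑ x
      - flux A B D F k (a / 2) (fun x => modes A B D F (k * (x + a / 2))) x)
    (fun x => ((hasDerivAt_flux A B D F k (a / 2) h x).const_mul 2).sub
      (hasDerivAt_flux_modes_comp A B D F k (a / 2) x)) hcφ (continuous_energyDensity h k) (fun x => by
      simp only [energyDensity, iteratedDeriv_two_modes_comp, deriv_modes_comp]
      nlinarith [sq_nonneg (iteratedDeriv 2 ϑ x
          - k ^ 2 * modes (A + B + B) B (D + F + F) F (k * (x + a / 2))),
        sq_nonneg (k * (deriv ϑ x - k * modes (D + F) F (A + B) B (k * (x + a / 2)))),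
        sq_nonneg (k ^ 2 * (ϑ x - modes A B D F (k * (x + a / 2))))])
  have f1 := flux_sub_eq_modesEnergy A B D F hm
  have f2 := flux_sub_eq_modesEnergy A B D F (matchesModes_modes_comp a k A B D F)
  linarith

lemma self_lt_sinh_mul_cosh {τ : ℝ} (hτ : 0 < τ) : τ < sinh τ * cosh τ := by
  have h := self_lt_sinh_iff.2 (mul_pos two_pos hτ)
  rw [sinh_two_mul] at h
  linarith

/-- Hermite interpolation at `±τ` by `modes`. -/
lemma exists_modes_eq {τ : ℝ} (hτ : 0 < τ) (u₁ u₀ w₁ w₀ : ℝ) :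
    ∃ A B D F : ℝ, u₁ = modes A B D F τ ∧ u₀ = modes A B D F (-τ) ∧
      w₁ = modes (D + F) F (A + B) B τ ∧ w₀ = modes (D + F) F (A + B) B (-τ) := by
  have hσ := self_lt_sinh_mul_cosh hτ
  have hC := cosh_sq τ
  simp only [modes, cosh_neg, sinh_neg]
  generalize cosh τ = C at *
  generalize sinh τ = S at *
  have hp : S * C + τ ≠ 0 := by linarith
  have hm : S * C - τ ≠ 0 := by linarith
  obtain ⟨A, B, even_val, even_deriv⟩ : ∃ A B : ℝ, A * C + B * (τ * S) = (u₁ + u₀) / 2 ∧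
      (A + B) * S + B * (τ * C) = (w₁ - w₀) / 2 := by
    generalize (u₁ + u₀) / 2 = u
    generalize (w₁ - w₀) / 2 = w
    refine ⟨(u * (S + τ * C) - w * (τ * S)) / (S * C + τ), (w * C - u * S) / (S * C + τ),
      ?_, ?_⟩
    · field_simp
      linear_combination u * τ * hC
    · field_simp
      linear_combination w * τ * hC
  obtain ⟨D, F, odd_val, odd_deriv⟩ : ∃ D F : ℝ, D * S + F * (τ * C) = (u₁ - u₀) / 2 ∧
      (D + F) * C + F * (τ * S) = (w₁ + w₀) / 2 := by
    generalize (u₁ - u₀) / 2 = u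
    generalize (w₁ + w₀) / 2 = w
    refine ⟨(u * (C + τ * S) - w * (τ * C)) / (S * C - τ), (w * S - u * C) / (S * C - τ),
      ?_, ?_⟩
    · rw [div_mul_eq_mul_div, div_mul_eq_mul_div, ← add_div, div_eq_iff hm]
      linear_combination -u * τ * hC
    · rw [← add_div, div_mul_eq_mul_div, div_mul_eq_mul_div, ← add_div, div_eq_iff hm]
      linear_combination -w * τ * hC
  refine ⟨A, B, D, F, ?_, ?_, ?_, ?_⟩
  · linear_combination -even_val - odd_val
  · linear_combination -even_val + odd_val
  · linear_combination -even_deriv - odd_deriv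
  · linear_combination even_deriv - odd_deriv

lemma modesBoundary_lower_bound {τ : ℝ} (hτ : 0 < τ) (A B D F : ℝ) :
    0 ≤ (sinh τ * cosh τ + τ) * modesEnergy A B D F τ
      + (3 * (sinh τ * cosh τ) - τ) * modesBoundary A B D F τ := by
  have hσ := self_lt_sinh_mul_cosh hτ
  have hC := cosh_sq τ
  simp only [modesEnergy, modesBoundary]
  generalize cosh τ = C at *
  generalize sinh τ = S at *
  have hpos : 0 ≤ S * C - τ := by linarith
  calc 0 ≤ 4 * ((2 * (S * C) * A + B * (S * C + τ + 2 * τ * S ^ 2)) ^ 2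
        + (2 * (S * C) * D + F * (S * C + τ + 2 * τ * S ^ 2)) ^ 2
        + F ^ 2 * (2 * τ * (S * C - τ))) := by positivity
    _ = _ := by
      linear_combination (-16 * τ * (S * C * A * B + B ^ 2 * τ * S ^ 2 + S * C * D * F
        + F ^ 2 * (S * C + τ * S ^ 2))) * hC

lemma div_mem_boundaryValues {a k : ℝ} {ϑ : ℝ → ℝ} (h : ContDiff ℝ 2 ϑ)
    (hE : 0 < ∫ x in Ioo (-a) (0 : ℝ), energyDensity k ϑ x) :
    boundaryTerm a k ϑ / (∫ x in Ioo (-a) (0 : ℝ), energyDensity k ϑ x) ∈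
      boundaryValues a k := by
  set E := ∫ x in Ioo (-a) (0 : ℝ), energyDensity k ϑ x with hEdef
  have hc : (√E)⁻¹ ^ 2 = E⁻¹ := by rw [inv_pow, Real.sq_sqrt hE.le]
  generalize (√E)⁻¹ = c at hc
  have hd : deriv (fun x => c * ϑ x) = fun x => c * deriv ϑ x :=
    funext fun x => ((hasDerivAt_of_contDiff_two h x).const_mul c).deriv
  have hdd : iteratedDeriv 2 (fun x => c * ϑ x) = fun x => c * iteratedDeriv 2 ϑ x := by
    rw [iteratedDeriv_succ, iteratedDeriv_one, hd]
    exact funext fun x => ((hasDerivAt_deriv_of_contDiff_two h x).const_mul c).deriv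
  refine ⟨fun x => c * ϑ x, contDiff_const.mul h, ?_, ?_⟩
  · have : energyDensity k (fun x => c * ϑ x) = fun x => E⁻¹ * energyDensity k ϑ x := by
      funext x
      rw [energyDensity, energyDensity, hd, hdd, ← hc]
      ring
    rw [this, integral_const_mul, ← hEdef, inv_mul_cancel₀ hE.ne']
  · rw [boundaryTerm, boundaryTerm, hd, div_eq_mul_inv, ← hc]
    ring

lemma modes_div_mem_boundaryValues {a k : ℝ} (ha : 0 < a) (hk : 0 < k) (A B D F : ℝ)
    (hE : 0 < modesEnergy A B D F (k * (a / 2))) :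
    modesBoundary A B D F (k * (a / 2)) / modesEnergy A B D F (k * (a / 2)) ∈
      boundaryValues a k := by
  have hk3 : 0 < k ^ 3 := by positivity
  have hI := energy_modes_comp A B D F k ha
  have hB := boundaryTerm_eq_modesBoundary A B D F (matchesModes_modes_comp a k A B D F)
  have := div_mem_boundaryValues (a := a) (k := k)
    (contDiff_modes_comp A B D F k (a / 2)) (by rw [hI]; positivity)
  rwa [hI, hB, mul_div_mul_left _ _ hk3.ne'] at this

lemma isGreatest_boundaryValues {a k : ℝ} (ha : 0 < a) (hk : 0 < k) :
    IsGreatest (boundaryValues a k) 1 := by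
  constructor
  · have hτ : 0 < k * (a / 2) := by positivity
    have hσ := hτ.trans (self_lt_sinh_mul_cosh hτ)
    have hE : 0 < modesEnergy 1 0 0 0 (k * (a / 2)) := by
      simp only [modesEnergy]
      nlinarith
    have hEB : modesBoundary 1 0 0 0 (k * (a / 2)) = modesEnergy 1 0 0 0 (k * (a / 2)) := by
      simp only [modesEnergy, modesBoundary]
      ring
    simpa [hEB, div_self hE.ne'] using modes_div_mem_boundaryValues ha hk 1 0 0 0 hE
  · rintro v ⟨ϑ, h, hE, rfl⟩
    exact (boundaryTerm_le_energy ha h).trans_eq hE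

lemma isLeast_boundaryValues {a k : ℝ} (ha : 0 < a) (hk : 0 < k) :
    IsLeast (boundaryValues a k)
      (-(sinh (k * a) + k * a) / (3 * sinh (k * a) - k * a)) := by
  have hka : k * a = 2 * (k * (a / 2)) := by ring
  have hτ : 0 < k * (a / 2) := by positivity
  rw [hka, sinh_two_mul]
  have hσ := self_lt_sinh_mul_cosh hτ
  constructor
  · have hmem := modes_div_mem_boundaryValues ha hk
      (-(sinh (k * (a / 2)) * cosh (k * (a / 2)) + k * (a / 2)
        + 2 * (k * (a / 2)) * sinh (k * (a / 2)) ^ 2))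
      (2 * (sinh (k * (a / 2)) * cosh (k * (a / 2)))) 0 0
    have hC := cosh_sq (k * (a / 2))
    revert hmem
    generalize k * (a / 2) = τ at *
    simp only [modesEnergy, modesBoundary]
    generalize cosh τ = C at *
    generalize sinh τ = S at *
    have hW : 4 * ((-(S * C + τ + 2 * τ * S ^ 2) * C + 2 * (S * C) * (τ * S))
          * ((-(S * C + τ + 2 * τ * S ^ 2) + 2 * (S * C)) * S + 2 * (S * C) * (τ * C))
        + (0 * S + 0 * (τ * C)) * ((0 + 0) * C + 0 * (τ * S)))
        = -(2 * (S * C) + 2 * τ) * (2 * (S * C) * (S * C + τ)) := by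
      linear_combination (-8 * (S * C) * τ * (S * C + τ)) * hC
    have hQ : 4 * ((-(S * C + τ + 2 * τ * S ^ 2) * C + 2 * (S * C) * (τ * S))
          * ((-(S * C + τ + 2 * τ * S ^ 2) + 2 * (S * C)) * S + 2 * (S * C) * (τ * C))
        + (0 * S + 0 * (τ * C)) * ((0 + 0) * C + 0 * (τ * S))
        + (2 * (S * C)) ^ 2 * (S * C + τ) + 0 ^ 2 * (S * C - τ))
        = (3 * (2 * (S * C)) - 2 * τ) * (2 * (S * C) * (S * C + τ)) := by
      linear_combination hW
    have hf : 0 < 2 * (S * C) * (S * C + τ) :=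
      mul_pos (by linarith) (by linarith)
    rw [hW, hQ, mul_div_mul_right _ _ hf.ne', mul_assoc 2 S C]
    exact fun hmem => hmem (mul_pos (by linarith) hf)
  · rintro v ⟨ϑ, h, hE, rfl⟩
    obtain ⟨A, B, D, F, v0, v1, w0, w1⟩ :=
      exists_modes_eq hτ (ϑ 0) (ϑ (-a)) (deriv ϑ 0 / k) (deriv ϑ (-a) / k)
    rw [div_eq_iff hk.ne', mul_comm _ k] at w0 w1
    have hm : MatchesModes a k A B D F ϑ := ⟨v0, v1, w0, w1⟩
    have hle := modesEnergy_le_energy A B D F ha h hm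
    have hB := boundaryTerm_eq_modesBoundary A B D F hm
    have hq := mul_nonneg (pow_pos hk 3).le (modesBoundary_lower_bound hτ A B D F)
    rw [hE] at hle
    rw [hB, div_le_iff₀ (by linarith)]
    nlinarith [mul_le_mul_of_nonneg_left hle (by linarith :
      0 ≤ sinh (k * (a / 2)) * cosh (k * (a / 2)) + k * (a / 2))]

theorem statement5 (a k : ℝ) (ha : 0 < a) (hk : 0 < k) :
    IsLeast
      {v : ℝ | ∃ ϑ : ℝ → ℝ, ContDiff ℝ 2 ϑ ∧
        (∫ x in Ioo (-a) (0 : ℝ),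
          ((iteratedDeriv 2 ϑ x) ^ 2 + 2 * k ^ 2 * (deriv ϑ x) ^ 2 + k ^ 4 * (ϑ x) ^ 2)) = 1 ∧
        v = 2 * k ^ 2 * (deriv ϑ 0 * ϑ 0 - deriv ϑ (-a) * ϑ (-a))}
      (-(Real.sinh (k * a) + k * a) / (3 * Real.sinh (k * a) - k * a)) ∧
    IsGreatest
      {v : ℝ | ∃ ϑ : ℝ → ℝ, ContDiff ℝ 2 ϑ ∧
        (∫ x in Ioo (-a) (0 : ℝ),
          ((iteratedDeriv 2 ϑ x) ^ 2 + 2 * k ^ 2 * (deriv ϑ x) ^ 2 + k ^ 4 * (ϑ x) ^ 2)) = 1 ∧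
        v = 2 * k ^ 2 * (deriv ϑ 0 * ϑ 0 - deriv ϑ (-a) * ϑ (-a))}
      1 := by
  exact ⟨isLeast_boundaryValues ha hk, isGreatest_boundaryValues ha hk⟩
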